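/- For every integer k ≥ 3 there exists a constant c > 0 such that for every integer q > k, every finite set of at least c·q² points in the plane ℝ² contains either q collinear points or q points with at most k collinear. (In the paper's notation: GP_k(q) ≤ O(q²), where GP_k(q) is the minimum integer such that every set of at least GP_k(q) points contains q collinear points or q points with at most k collinear.) -/

import Mathlib

/-- A finite point set has "at most k collinear" if every collinear subset has ≤ k points. -/
def AtMostCollinear (S : Finset (ℝ × ℝ)) (k : ℕ) : Prop :=
  ∀ T ⊆ S, Collinear ℝ (T : Set (ℝ × ℝ)) → T.card ≤ k

/-- A non-vertical segment: the part of the line `y = slope * x + icept` over `[left, right]`. -/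
@[ext]
structure Seg where
  slope : ℝ
  icept : ℝ
  left : ℝ
  right : ℝ

namespace Seg

/-- The height of the line carrying the segment. -/
def height (e : Seg) (x : ℝ) : ℝ := e.slope * x + e.icept

/-- The left endpoint. -/
def leftPt (e : Seg) : ℝ × ℝ := (e.left, e.height e.left)

/-- The right endpoint. -/
def rightPt (e : Seg) : ℝ × ℝ := (e.right, e.height e.right)

/-- The reflection of a segment in the vertical axis. -/
def mirror (e : Seg) : Seg := ⟨-e.slope, e.icept, -e.right, -e.left⟩

lemma mirror_mirror (e : Seg) : e.mirror.mirror = e := by simp [mirror]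

lemma height_mirror (e : Seg) (x : ℝ) : e.mirror.height x = e.height (-x) := by
  simp [mirror, height]

end Seg

/-- The segments of `E` have their endpoints in `V`, contain no point of `V` in their relative
interiors, and have pairwise disjoint relative interiors. -/
structure IsPlaneGraph (V : Set (ℝ × ℝ)) (E : Set Seg) : Prop where
  left_lt_right : ∀ e ∈ E, e.left < e.right
  leftPt_mem : ∀ e ∈ E, e.leftPt ∈ V
  rightPt_mem : ∀ e ∈ E, e.rightPt ∈ V
  vertex_notMem : ∀ e ∈ E, ∀ v ∈ V, e.left < v.1 → v.1 < e.right → v.2 ≠ e.height v.1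
  eq_of_meet : ∀ e ∈ E, ∀ f ∈ E, ∀ x, e.left < x → x < e.right → f.left < x → x < f.right →
    e.height x = f.height x → e = f

lemma exists_affine_root {a b x y : ℝ} (hxy : x ≤ y) (hx : 0 < a * x + b) (hy : a * y + b ≤ 0) :
    ∃ t, x < t ∧ t ≤ y ∧ a * t + b = 0 := by
  have ha : a < 0 := by
    by_contra! h
    nlinarith
  have ha' := ha.ne
  refine ⟨-b / a, ?_, ?_, by field_simp; ring⟩
  · rw [lt_div_iff_of_neg ha]; linarith
  · rw [div_le_iff_of_neg ha]; linarith

lemma Seg.exists_meet {e f : Seg} {x y : ℝ} (hxy : x ≤ y) (hx : e.height x < f.height x)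
    (hy : f.height y ≤ e.height y) : ∃ t, x < t ∧ t ≤ y ∧ f.height t = e.height t := by
  simp only [Seg.height] at *
  obtain ⟨t, h1, h2, h3⟩ := exists_affine_root (a := f.slope - e.slope) (b := f.icept - e.icept)
    hxy (by linarith) (by linarith)
  exact ⟨t, h1, h2, by linarith⟩

namespace IsPlaneGraph

variable {V : Set (ℝ × ℝ)} {E : Set Seg}

lemma mirror (h : IsPlaneGraph V E) :
    IsPlaneGraph {z | (-z.1, z.2) ∈ V} {e | e.mirror ∈ E} where
  left_lt_right e he := by
    have := h.left_lt_right _ he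
    simp only [Seg.mirror] at this
    linarith
  leftPt_mem e he := by
    have := h.rightPt_mem _ he
    simpa [Seg.rightPt, Seg.leftPt, Seg.height_mirror, Seg.mirror, Seg.height] using this
  rightPt_mem e he := by
    have := h.leftPt_mem _ he
    simpa [Seg.rightPt, Seg.leftPt, Seg.height_mirror, Seg.mirror, Seg.height] using this
  vertex_notMem e he v hv h1 h2 := by
    have := h.vertex_notMem _ he _ hv (by simp [Seg.mirror, h2]) (by simp [Seg.mirror, h1])
    simpa [Seg.height_mirror] using this
  eq_of_meet e he f hf x h1 h2 h3 h4 h5 := by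
    have := h.eq_of_meet _ he _ hf (-x) (by simp [Seg.mirror, h2]) (by simp [Seg.mirror, h1])
      (by simp [Seg.mirror, h4]) (by simp [Seg.mirror, h3]) (by simpa [Seg.height_mirror] using h5)
    rw [← e.mirror_mirror, this, f.mirror_mirror]

/-- The triangle over `e` cut off by the lines of `e'` and `e''`, without its base. -/
def InTriangle (e e' e'' : Seg) (z : ℝ × ℝ) : Prop :=
  e.height z.1 < z.2 ∧ z.2 ≤ e'.height z.1 ∧ z.2 ≤ e''.height z.1

lemma height_le_of_lowest_of_slope_le (h : IsPlaneGraph V E) {e e' e'' f : Seg} (he : e ∈ E)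
    (he'' : e'' ∈ E) (hf : f ∈ E)
    (hs' : e.slope < e'.slope) (hr : e''.rightPt = e.rightPt) (hs'' : e''.slope < e.slope)
    (hnext : ∀ g ∈ E, g.rightPt = e.rightPt → g.slope < e.slope → g.slope ≤ e''.slope)
    {w : ℝ × ℝ} (hw : InTriangle e e' e'' w) (hwr : w.1 < e.right) (hwl : e.left < w.1)
    (hmin : ∀ z ∈ V, InTriangle e e' e'' z → w.2 - e.height w.1 ≤ z.2 - e.height z.1)
    (hfl : f.left < w.1) (hfr : w.1 < f.right) (hfw : f.height w.1 < w.2)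
    (hfs : f.slope ≤ e.slope) : f.height w.1 ≤ e.height w.1 := by
  by_contra! hef
  obtain ⟨hw1, hw2, hw3⟩ := hw
  have hr1 : e''.right = e.right := congrArg Prod.fst hr
  have hr2 : e''.height e.right = e.height e.right := by
    have := congrArg Prod.snd hr
    simpa [Seg.rightPt, hr1] using this
  have above : ∀ x, w.1 ≤ x → x ≤ e.right → x ≤ f.right → e.height x < f.height x := by
    intro x hx1 hx2 hx3
    by_contra! hx
    obtain ⟨t, ht1, ht2, ht3⟩ := Seg.exists_meet hx1 hef hx
    rcases (ht2.trans hx2).lt_or_eq with hte | hte <;>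
      rcases (ht2.trans hx3).lt_or_eq with htf | htf
    · have := h.eq_of_meet f hf e he t (by linarith) htf (by linarith) hte ht3
      rw [this] at hef
      exact lt_irrefl _ hef
    · refine h.vertex_notMem e he _ (h.rightPt_mem f hf) ?_ ?_ ?_ <;>
        simp only [Seg.rightPt, ← htf]
      · linarith
      · exact hte
      · exact ht3
    · refine h.vertex_notMem f hf _ (h.rightPt_mem e he) ?_ ?_ ?_ <;>
        simp only [Seg.rightPt, ← hte]
      · linarith
      · exact htf
      · exact ht3.symm
    · have hfe : f.rightPt = e.rightPt := by
        simp only [Seg.rightPt, ← hte, ← htf, ht3]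
      have hlt : f.slope < e.slope := by
        simp only [Seg.height] at *
        nlinarith
      have := hnext f hf hfe hlt
      rw [← hte] at hr2
      simp only [Seg.height] at *
      nlinarith
  have below : ∀ x, w.1 ≤ x → f.height x ≤ e'.height x := by
    intro x hx
    simp only [Seg.height] at *
    nlinarith
  have closer : ∀ x, w.1 ≤ x → f.height x - e.height x < w.2 - e.height w.1 := by
    intro x hx
    simp only [Seg.height] at *
    nlinarith
  obtain ⟨t, ht1, ht2, ht3, ht4⟩ : ∃ t, w.1 < t ∧ t < e.right ∧ t < f.right ∧
      f.height t = e''.height t := by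
    have key : ∀ y, w.1 ≤ y → e''.height y < f.height y →
        ∃ t, w.1 < t ∧ t < y ∧ f.height t = e''.height t := by
      intro y hy hlt
      obtain ⟨t, ht1, ht2, ht3⟩ := Seg.exists_meet hy (hfw.trans_le hw3) hlt.le
      refine ⟨t, ht1, lt_of_le_of_ne ht2 ?_, ht3.symm⟩
      rintro rfl
      linarith
    by_cases hc : f.right < e.right
    · have hz := above f.right hfr.le hc.le le_rfl
      by_cases hd : e''.height f.right < f.height f.right
      · obtain ⟨t, h1, h2, h3⟩ := key _ hfr.le hd
        exact ⟨t, h1, h2.trans hc, h2, h3⟩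
      · exact absurd (hmin f.rightPt (h.rightPt_mem f hf)
          ⟨hz, below _ hfr.le, not_lt.1 hd⟩) (not_le.2 (closer _ hfr.le))
    · obtain ⟨t, h1, h2, h3⟩ := key e.right hwr.le
        (hr2.trans_lt (above _ hwr.le le_rfl (not_lt.1 hc)))
      exact ⟨t, h1, h2, h2.trans_le (not_lt.1 hc), h3⟩
  by_cases hl : e''.left < t
  · have := h.eq_of_meet f hf e'' he'' t (by linarith) ht3 hl (by linarith) ht4
    rw [this] at hfw
    linarith
  · have hl2 := h.left_lt_right _ he''
    push Not at hl
    have hb := below t ht1.le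
    have hc := closer t ht1.le
    refine absurd (hmin e''.leftPt (h.leftPt_mem _ he'') ⟨?_, ?_, le_rfl⟩) (not_le.2 ?_) <;>
      simp only [Seg.leftPt, Seg.height] at * <;> nlinarith

lemma height_le_of_lowest (h : IsPlaneGraph V E) {e e' e'' f : Seg} (he : e ∈ E)
    (he' : e' ∈ E) (he'' : e'' ∈ E) (hf : f ∈ E)
    (hl : e'.leftPt = e.leftPt) (hs' : e.slope < e'.slope)
    (hnext' : ∀ g ∈ E, g.leftPt = e.leftPt → e.slope < g.slope → e'.slope ≤ g.slope)
    (hr : e''.rightPt = e.rightPt) (hs'' : e''.slope < e.slope)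
    (hnext'' : ∀ g ∈ E, g.rightPt = e.rightPt → g.slope < e.slope → g.slope ≤ e''.slope)
    {w : ℝ × ℝ} (hw : InTriangle e e' e'' w) (hwr : w.1 < e.right) (hwl : e.left < w.1)
    (hmin : ∀ z ∈ V, InTriangle e e' e'' z → w.2 - e.height w.1 ≤ z.2 - e.height z.1)
    (hfl : f.left < w.1) (hfr : w.1 < f.right) (hfw : f.height w.1 < w.2) :
    f.height w.1 ≤ e.height w.1 := by
  rcases le_total f.slope e.slope with hfs | hfs
  · exact h.height_le_of_lowest_of_slope_le he he'' hf hs' hr hs'' hnext'' hw hwr hwl hmin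
      hfl hfr hfw hfs
  · have mem : ∀ g ∈ E, g.mirror ∈ {e : Seg | e.mirror ∈ E} := fun g hg => by
      simpa [Seg.mirror_mirror] using hg
    have right : ∀ g : Seg, g.mirror.rightPt = (-g.leftPt.1, g.leftPt.2) := fun g => by
      simp [Seg.rightPt, Seg.leftPt, Seg.height, Seg.mirror]
    have left : ∀ g : Seg, g.mirror.leftPt = (-g.rightPt.1, g.rightPt.2) := fun g => by
      simp [Seg.rightPt, Seg.leftPt, Seg.height, Seg.mirror]
    have := h.mirror.height_le_of_lowest_of_slope_le (e := e.mirror) (e' := e''.mirror)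
      (e'' := e'.mirror) (f := f.mirror) (w := (-w.1, w.2)) (mem _ he) (mem _ he') (mem _ hf)
      (by simpa [Seg.mirror] using hs'') (by rw [right, right, hl])
      (by simpa [Seg.mirror] using hs') ?_ ?_ (by simpa [Seg.mirror] using hwl)
      (by simpa [Seg.mirror] using hwr) ?_ (by simpa [Seg.mirror] using hfr)
      (by simpa [Seg.mirror] using hfl) (by simpa [Seg.height_mirror] using hfw)
      (by simpa [Seg.mirror] using hfs)
    · simpa [Seg.height_mirror] using this
    · intro g hg hge hgs
      have h1 := hnext' g.mirror hg (by rw [left, hge, right]; simp)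
        (by simp only [Seg.mirror] at hgs ⊢; linarith)
      simp only [Seg.mirror] at h1 ⊢
      linarith
    · simpa [InTriangle, Seg.height_mirror, and_comm] using hw
    · intro z hz hzt
      have := hmin _ hz (by simpa [InTriangle, Seg.height_mirror, and_comm] using hzt)
      simpa [Seg.height_mirror] using this

lemma exists_inTriangle (h : IsPlaneGraph V E) {e e' e'' : Seg} (he : e ∈ E)
    (he' : e' ∈ E) (he'' : e'' ∈ E)
    (hl : e'.leftPt = e.leftPt) (hs' : e.slope < e'.slope)
    (hr : e''.rightPt = e.rightPt) (hs'' : e''.slope < e.slope) :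
    ∃ w ∈ V, InTriangle e e' e'' w := by
  have hl1 : e'.left = e.left := congrArg Prod.fst hl
  have hl2 : e'.height e.left = e.height e.left := by
    have := congrArg Prod.snd hl
    simpa [Seg.leftPt, hl1] using this
  have hr1 : e''.right = e.right := congrArg Prod.fst hr
  have hr2 : e''.height e.right = e.height e.right := by
    have := congrArg Prod.snd hr
    simpa [Seg.rightPt, hr1] using this
  have h0 := h.left_lt_right _ he
  have h1 := h.left_lt_right _ he'
  have h2 := h.left_lt_right _ he''
  by_cases hc : e'.height e'.right ≤ e''.height e'.right
  · refine ⟨e'.rightPt, h.rightPt_mem _ he', ?_, le_rfl, hc⟩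
    simp only [Seg.rightPt, Seg.height] at *
    nlinarith
  by_cases hd : e''.height e''.left ≤ e'.height e''.left
  · refine ⟨e''.leftPt, h.leftPt_mem _ he'', ?_, hd, le_rfl⟩
    simp only [Seg.leftPt, Seg.height] at *
    nlinarith
  push Not at hc hd
  have hlr : e''.left ≤ e'.right := by
    simp only [Seg.height] at *
    by_contra! hlt
    nlinarith
  obtain ⟨t, ht1, ht2, ht3⟩ := Seg.exists_meet hlr hd hc.le
  have ht4 : t < e'.right := by
    refine lt_of_le_of_ne ht2 ?_
    rintro rfl
    linarith
  have hlt : e.left < t := by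
    simp only [Seg.height] at *
    by_contra! hlt
    nlinarith
  have htr : t < e.right := by
    simp only [Seg.height] at *
    by_contra! hlt
    nlinarith
  have := h.eq_of_meet _ he'' _ he' t ht1 (by linarith) (by linarith) ht4 ht3
  rw [this] at hs''
  linarith

end IsPlaneGraph

section PlaneGraphCard

variable {V : Finset (ℝ × ℝ)} {E : Finset Seg}

lemma IsPlaneGraph.exists_lowest_vertex_above (h : IsPlaneGraph (V : Set (ℝ × ℝ)) (E : Set Seg))
    {e : Seg} (he : e ∈ E)
    (hl : ∃ g ∈ E, g.leftPt = e.leftPt ∧ e.slope < g.slope)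
    (hr : ∃ g ∈ E, g.rightPt = e.rightPt ∧ g.slope < e.slope) :
    ∃ w ∈ V, e.left < w.1 ∧ w.1 < e.right ∧ e.height w.1 < w.2 ∧
      ∀ f ∈ E, f.left < w.1 → w.1 < f.right → f.height w.1 < w.2 →
        f.height w.1 ≤ e.height w.1 := by
  classical
  obtain ⟨e', he', hmin'⟩ := Finset.exists_min_image
    (E.filter fun g => g.leftPt = e.leftPt ∧ e.slope < g.slope) Seg.slope
    (by obtain ⟨g, hg⟩ := hl; exact ⟨g, by simpa using hg⟩)
  obtain ⟨e'', he'', hmax''⟩ := Finset.exists_max_image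
    (E.filter fun g => g.rightPt = e.rightPt ∧ g.slope < e.slope) Seg.slope
    (by obtain ⟨g, hg⟩ := hr; exact ⟨g, by simpa using hg⟩)
  simp only [Finset.mem_filter, and_imp] at he' hmin' he'' hmax''
  obtain ⟨he', hl', hs'⟩ := he'
  obtain ⟨he'', hr'', hs''⟩ := he''
  obtain ⟨w₀, hw₀, hw₀'⟩ := h.exists_inTriangle he he' he'' hl' hs' hr'' hs''
  obtain ⟨w, hw, hwmin⟩ := Finset.exists_min_image
    (V.filter (IsPlaneGraph.InTriangle e e' e'')) (fun z => z.2 - e.height z.1)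
    ⟨w₀, by simpa using ⟨hw₀, hw₀'⟩⟩
  simp only [Finset.mem_filter, and_imp] at hw hwmin
  obtain ⟨hwV, hwT⟩ := hw
  have hl1 : e'.left = e.left := congrArg Prod.fst hl'
  have hl2 : e'.height e.left = e.height e.left := by
    have := congrArg Prod.snd hl'
    simpa [Seg.leftPt, hl1] using this
  have hr1 : e''.right = e.right := congrArg Prod.fst hr''
  have hr2 : e''.height e.right = e.height e.right := by
    have := congrArg Prod.snd hr''
    simpa [Seg.rightPt, hr1] using this
  have hwl : e.left < w.1 := by
    obtain ⟨ha, hb, -⟩ := hwT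
    simp only [Seg.height] at *
    by_contra! hlt
    nlinarith
  have hwr : w.1 < e.right := by
    obtain ⟨ha, -, hb⟩ := hwT
    simp only [Seg.height] at *
    by_contra! hlt
    nlinarith
  exact ⟨w, hwV, hwl, hwr, hwT.1, fun f hf hfl hfr hfw =>
    h.height_le_of_lowest he he' he'' hf hl' hs' hmin' hr'' hs'' hmax'' hwT hwr hwl hwmin
      hfl hfr hfw⟩

lemma IsPlaneGraph.card_le (h : IsPlaneGraph (V : Set (ℝ × ℝ)) (E : Set Seg)) :
    E.card ≤ 3 * V.card := by
  classical
  set A := E.filter fun e => ∀ g ∈ E, g.leftPt = e.leftPt → g.slope ≤ e.slope with hA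
  set B := E.filter fun e => ∀ g ∈ E, g.rightPt = e.rightPt → e.slope ≤ g.slope with hB
  set C := E.filter fun e => (∃ g ∈ E, g.leftPt = e.leftPt ∧ e.slope < g.slope) ∧
    ∃ g ∈ E, g.rightPt = e.rightPt ∧ g.slope < e.slope with hC
  have hcover : E ⊆ A ∪ B ∪ C := by
    intro e he
    simp only [hA, hB, hC, Finset.mem_union, Finset.mem_filter, he, true_and]
    by_contra! hcon
    obtain ⟨⟨⟨g, hg⟩, ⟨g', hg'⟩⟩, h3⟩ := hcon
    have := h3 ⟨g, hg⟩ g' hg'.1 hg'.2.1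
    linarith [hg'.2.2]
  have hAcard : A.card ≤ V.card := by
    refine Finset.card_le_card_of_injOn Seg.leftPt
      (fun e he => h.leftPt_mem e (Finset.mem_filter.1 he).1) ?_
    intro e he f hf hef
    obtain ⟨he, he'⟩ := Finset.mem_filter.1 he
    obtain ⟨hf, hf'⟩ := Finset.mem_filter.1 hf
    have hs : e.slope = f.slope := le_antisymm (hf' e he hef) (he' f hf hef.symm)
    have h1 : e.left = f.left := congrArg Prod.fst hef
    have h2 : e.height e.left = f.height f.left := congrArg Prod.snd hef
    have h3 := h.left_lt_right _ he
    have h4 := h.left_lt_right _ hf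
    obtain ⟨x, hx1, hx2⟩ := exists_between (lt_min h3 (h1 ▸ h4))
    obtain ⟨hx2, hx3⟩ := lt_min_iff.1 hx2
    refine h.eq_of_meet e he f hf x hx1 hx2 (h1 ▸ hx1) hx3 ?_
    simp only [Seg.height, hs, h1] at *
    linarith
  have hBcard : B.card ≤ V.card := by
    refine Finset.card_le_card_of_injOn Seg.rightPt
      (fun e he => h.rightPt_mem e (Finset.mem_filter.1 he).1) ?_
    intro e he f hf hef
    obtain ⟨he, he'⟩ := Finset.mem_filter.1 he
    obtain ⟨hf, hf'⟩ := Finset.mem_filter.1 hf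
    have hs : e.slope = f.slope := le_antisymm (he' f hf hef.symm) (hf' e he hef)
    have h1 : e.right = f.right := congrArg Prod.fst hef
    have h2 : e.height e.right = f.height f.right := congrArg Prod.snd hef
    have h3 := h.left_lt_right _ he
    have h4 := h.left_lt_right _ hf
    obtain ⟨x, hx1, hx2⟩ := exists_between (max_lt h3 (h1 ▸ h4))
    obtain ⟨hx1, hx3⟩ := max_lt_iff.1 hx1
    refine h.eq_of_meet e he f hf x hx1 hx2 hx3 (h1 ▸ hx2) ?_
    simp only [Seg.height, hs, h1] at *
    linarith
  have hCcard : C.card ≤ V.card := by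
    have hex : ∀ e ∈ C, ∃ w ∈ V, e.left < w.1 ∧ w.1 < e.right ∧ e.height w.1 < w.2 ∧
        ∀ f ∈ E, f.left < w.1 → w.1 < f.right → f.height w.1 < w.2 →
          f.height w.1 ≤ e.height w.1 := fun e he =>
      have he := Finset.mem_filter.1 he
      h.exists_lowest_vertex_above he.1 he.2.1 he.2.2
    choose! φ hφV hφl hφr hφh hφ using hex
    refine Finset.card_le_card_of_injOn φ hφV ?_
    intro e he f hf hef
    have heE := (Finset.mem_filter.1 he).1
    have hfE := (Finset.mem_filter.1 hf).1
    have hfl := hφl f hf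
    have hfr := hφr f hf
    have hfh := hφh f hf
    have hfb := hφ f hf e heE
    rw [← hef] at hfl hfr hfh hfb
    exact h.eq_of_meet e heE f hfE (φ e).1 (hφl e he) (hφr e he) hfl hfr
      (le_antisymm (hfb (hφl e he) (hφr e he) (hφh e he)) (hφ e he f hfE hfl hfr hfh))
  calc E.card ≤ (A ∪ B ∪ C).card := Finset.card_le_card hcover
    _ ≤ A.card + B.card + C.card :=
      (Finset.card_union_le _ _).trans (Nat.add_le_add_right (Finset.card_union_le _ _) _)
    _ ≤ 3 * V.card := by omega

end PlaneGraphCard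

section Sampling

variable {α : Type*} [DecidableEq α]

/-- The probability that `S` is the random subset of `V` containing each point independently with
probability `p`. -/
def binomialWeight (V : Finset α) (p : ℝ) (S : Finset α) : ℝ := p ^ S.card * (1 - p) ^ (V \ S).card

lemma binomialWeight_nonneg (V : Finset α) {p : ℝ} (hp : 0 ≤ p) (hp' : p ≤ 1) (S : Finset α) :
    0 ≤ binomialWeight V p S :=
  mul_nonneg (pow_nonneg hp _) (pow_nonneg (sub_nonneg.2 hp') _)

lemma sum_binomialWeight_of_subset {V T : Finset α} (p : ℝ) (hT : T ⊆ V) :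
    ∑ S ∈ V.powerset with T ⊆ S, binomialWeight V p S = p ^ T.card := by
  have h := Finset.prod_add (fun _ => p) (fun i => if i ∈ T then 0 else 1 - p) V
  have h1 : ∏ i ∈ V, (p + if i ∈ T then 0 else 1 - p) = p ^ T.card := by
    have : ∀ i ∈ V, (p + if i ∈ T then 0 else 1 - p) = if i ∈ T then p else 1 := by
      intro i _
      split_ifs <;> ring
    rw [Finset.prod_congr rfl this, Finset.prod_ite_mem, Finset.inter_eq_right.2 hT,
      Finset.prod_const]
  rw [← h1, h, Finset.sum_filter]
  refine Finset.sum_congr rfl fun S hS => ?_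
  rw [Finset.prod_const]
  split_ifs with hTS
  · rw [binomialWeight, ← Finset.prod_const (s := V \ S)]
    congr 1
    refine Finset.prod_congr rfl fun i hi => ?_
    rw [if_neg fun hiT => (Finset.mem_sdiff.1 hi).2 (hTS hiT)]
  · obtain ⟨i, hiT, hiS⟩ := Finset.not_subset.1 hTS
    rw [Finset.prod_eq_zero (Finset.mem_sdiff.2 ⟨hT hiT, hiS⟩) (by simp [hiT]), mul_zero]

lemma sum_binomialWeight (V : Finset α) (p : ℝ) :
    ∑ S ∈ V.powerset, binomialWeight V p S = 1 := by
  simpa using sum_binomialWeight_of_subset p (Finset.empty_subset V)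

lemma sum_binomialWeight_mul_card {ι : Type*} {V : Finset α} (p : ℝ) (I : Finset ι)
    (T : ι → Finset α) (r : ℕ) (hT : ∀ i ∈ I, T i ⊆ V) (hr : ∀ i ∈ I, (T i).card = r) :
    ∑ S ∈ V.powerset, binomialWeight V p S * ((I.filter fun i => T i ⊆ S).card : ℝ) =
      p ^ r * I.card := by
  calc _ = ∑ S ∈ V.powerset, ∑ i ∈ I, if T i ⊆ S then binomialWeight V p S else 0 := by
        refine Finset.sum_congr rfl fun S _ => ?_
        rw [← Finset.sum_filter, Finset.sum_const, nsmul_eq_mul, mul_comm]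
    _ = ∑ i ∈ I, p ^ r := by
        rw [Finset.sum_comm]
        refine Finset.sum_congr rfl fun i hi => ?_
        rw [← Finset.sum_filter, sum_binomialWeight_of_subset p (hT i hi), hr i hi]
    _ = p ^ r * I.card := by rw [Finset.sum_const, nsmul_eq_mul, mul_comm]

lemma sum_binomialWeight_mul_card_self (V : Finset α) (p : ℝ) :
    ∑ S ∈ V.powerset, binomialWeight V p S * (S.card : ℝ) = p * V.card := by
  have h := sum_binomialWeight_mul_card (V := V) p V (fun v => ({v} : Finset α)) 1
    (by simp) (by simp)
  rw [pow_one] at h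
  rw [← h]
  refine Finset.sum_congr rfl fun S hS => ?_
  simp only [Finset.singleton_subset_iff, Finset.filter_mem_eq_inter,
    Finset.inter_eq_right.2 (Finset.mem_powerset.1 hS)]

end Sampling

section RichLines

open scoped Classical in
/-- The points of `V` on the line `y = ℓ.1 * x + ℓ.2`. -/
noncomputable def linePts (V : Finset (ℝ × ℝ)) (ℓ : ℝ × ℝ) : Finset (ℝ × ℝ) :=
  V.filter fun v => v.2 = ℓ.1 * v.1 + ℓ.2

lemma mem_linePts {V : Finset (ℝ × ℝ)} {ℓ v : ℝ × ℝ} :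
    v ∈ linePts V ℓ ↔ v ∈ V ∧ v.2 = ℓ.1 * v.1 + ℓ.2 := by
  simp [linePts]

open scoped Classical in
/-- The segments joining consecutive points of `V` on the lines of `L`. -/
noncomputable def consecutiveSegs (V L : Finset (ℝ × ℝ)) : Finset Seg :=
  ((L ×ˢ V ×ˢ V).image fun t => (⟨t.1.1, t.1.2, t.2.1.1, t.2.2.1⟩ : Seg)).filter fun e =>
    e.leftPt ∈ V ∧ e.rightPt ∈ V ∧ e.left < e.right ∧
      ∀ v ∈ V, e.left < v.1 → v.1 < e.right → v.2 ≠ e.height v.1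

lemma mem_consecutiveSegs {V L : Finset (ℝ × ℝ)} {e : Seg} :
    e ∈ consecutiveSegs V L ↔ (e.slope, e.icept) ∈ L ∧ e.leftPt ∈ V ∧ e.rightPt ∈ V ∧
      e.left < e.right ∧ ∀ v ∈ V, e.left < v.1 → v.1 < e.right → v.2 ≠ e.height v.1 := by
  simp only [consecutiveSegs, Finset.mem_filter, Finset.mem_image, Finset.mem_product]
  constructor
  · rintro ⟨⟨t, ht, rfl⟩, h⟩
    exact ⟨ht.1, h⟩
  · rintro ⟨h1, h2, h3, h⟩
    exact ⟨⟨((e.slope, e.icept), e.leftPt, e.rightPt), ⟨h1, h2, h3⟩, rfl⟩, h2, h3, h⟩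

lemma card_linePts_sub_one_le (V L : Finset (ℝ × ℝ)) {ℓ : ℝ × ℝ} (hℓ : ℓ ∈ L) :
    (linePts V ℓ).card - 1 ≤
      ((consecutiveSegs V L).filter fun e => (e.slope, e.icept) = ℓ).card := by
  classical
  rcases (linePts V ℓ).eq_empty_or_nonempty with h0 | h0
  · simp [h0]
  obtain ⟨m, hm, hmax⟩ := Finset.exists_max_image _ Prod.fst h0
  rw [← Finset.card_erase_of_mem hm]
  refine Finset.card_le_card_of_surjOn Seg.leftPt ?_
  intro u hu
  obtain ⟨hum, hu⟩ := Finset.mem_erase.1 hu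
  have hu' := mem_linePts.1 hu
  have hm' := mem_linePts.1 hm
  have hlt : u.1 < m.1 := by
    refine lt_of_le_of_ne (hmax u hu) fun h => hum (Prod.ext h ?_)
    rw [hu'.2, hm'.2, h]
  obtain ⟨v, hv, hmin⟩ := Finset.exists_min_image
    ((linePts V ℓ).filter fun z => u.1 < z.1) Prod.fst ⟨m, by simp [hm, hlt]⟩
  simp only [Finset.mem_filter, and_imp] at hv hmin
  have hv' := mem_linePts.1 hv.1
  refine ⟨⟨ℓ.1, ℓ.2, u.1, v.1⟩, ?_, ?_⟩
  · rw [Finset.mem_coe, Finset.mem_filter, mem_consecutiveSegs]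
    refine ⟨⟨hℓ, ?_, ?_, hv.2, ?_⟩, rfl⟩
    · simpa only [Seg.leftPt, Seg.height, ← hu'.2] using hu'.1
    · simpa only [Seg.rightPt, Seg.height, ← hv'.2] using hv'.1
    · intro z hz h1 h2 h3
      exact absurd (hmin z (mem_linePts.2 ⟨hz, h3⟩) h1) (not_le.2 h2)
  · simp only [Seg.leftPt, Seg.height, ← hu'.2]

lemma sum_card_linePts_sub_one_le (V L : Finset (ℝ × ℝ)) :
    ∑ ℓ ∈ L, ((linePts V ℓ).card - 1) ≤ (consecutiveSegs V L).card := by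
  classical
  rw [Finset.card_eq_sum_card_fiberwise (f := fun e : Seg => (e.slope, e.icept)) (t := L)
    fun e he => (mem_consecutiveSegs.1 he).1]
  exact Finset.sum_le_sum fun ℓ hℓ => card_linePts_sub_one_le V L hℓ

/-- Two distinct segments share a point of their relative interiors. -/
def Seg.Crosses (e f : Seg) : Prop :=
  e ≠ f ∧ ∃ x, e.left < x ∧ x < e.right ∧ f.left < x ∧ x < f.right ∧ e.height x = f.height x

lemma eq_of_mem_consecutiveSegs_of_line_eq {V L : Finset (ℝ × ℝ)} {e f : Seg}
    (he : e ∈ consecutiveSegs V L) (hf : f ∈ consecutiveSegs V L) (hs : e.slope = f.slope)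
    (hi : e.icept = f.icept) {x : ℝ} (h1 : e.left < x) (h2 : x < e.right) (h3 : f.left < x)
    (h4 : x < f.right) : e = f := by
  obtain ⟨-, hel, her, -, hev⟩ := mem_consecutiveSegs.1 he
  obtain ⟨-, hfl, hfr, -, hfv⟩ := mem_consecutiveSegs.1 hf
  have hh : ∀ y, e.height y = f.height y := fun y => by simp [Seg.height, hs, hi]
  refine Seg.ext hs hi ?_ ?_
  · rcases lt_trichotomy e.left f.left with h | h | h
    · exact absurd (hh _).symm (hev _ hfl h (h3.trans h2))
    · exact h
    · exact absurd (hh _) (hfv _ hel h (h1.trans h4))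
  · rcases lt_trichotomy e.right f.right with h | h | h
    · exact absurd (hh _) (hfv _ her (h3.trans h2) h)
    · exact h
    · exact absurd (hh _).symm (hev _ hfr (h1.trans h4) h)

lemma line_ne_of_crosses {V L : Finset (ℝ × ℝ)} {e f : Seg}
    (he : e ∈ consecutiveSegs V L) (hf : f ∈ consecutiveSegs V L) (h : e.Crosses f) :
    e.slope ≠ f.slope := by
  intro hs
  obtain ⟨hne, x, h1, h2, h3, h4, h5⟩ := h
  refine hne (eq_of_mem_consecutiveSegs_of_line_eq he hf hs ?_ h1 h2 h3 h4)
  simp only [Seg.height, hs] at h5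
  linarith

lemma Seg.eq_of_height_eq {e f : Seg} (hs : e.slope ≠ f.slope) {x y : ℝ}
    (hx : e.height x = f.height x) (hy : e.height y = f.height y) : x = y := by
  simp only [Seg.height] at hx hy
  have : (e.slope - f.slope) * (x - y) = 0 := by linarith
  rcases mul_eq_zero.1 this with h | h
  · exact absurd (sub_eq_zero.1 h) hs
  · exact sub_eq_zero.1 h

open scoped Classical in
/-- The ordered pairs of crossing segments of `E`. -/
noncomputable def crossingPairs (E : Finset Seg) : Finset (Seg × Seg) :=
  (E ×ˢ E).filter fun t => t.1.Crosses t.2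

lemma mem_crossingPairs {E : Finset Seg} {t : Seg × Seg} :
    t ∈ crossingPairs E ↔ t.1 ∈ E ∧ t.2 ∈ E ∧ t.1.Crosses t.2 := by
  simp [crossingPairs, and_assoc]

lemma card_crossingPairs_le (V L : Finset (ℝ × ℝ)) :
    (crossingPairs (consecutiveSegs V L)).card ≤ L.card ^ 2 := by
  rw [sq, ← Finset.card_product]
  refine Finset.card_le_card_of_injOn
    (fun t => ((t.1.slope, t.1.icept), (t.2.slope, t.2.icept))) ?_ ?_
  · intro t ht
    obtain ⟨h1, h2, -⟩ := mem_crossingPairs.1 ht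
    exact Finset.mem_product.2 ⟨(mem_consecutiveSegs.1 h1).1, (mem_consecutiveSegs.1 h2).1⟩
  · rintro ⟨e, f⟩ ht ⟨e', f'⟩ ht' h
    obtain ⟨he, hf, hc⟩ := mem_crossingPairs.1 ht
    obtain ⟨he', hf', hc'⟩ := mem_crossingPairs.1 ht'
    have hs := line_ne_of_crosses he hf hc
    obtain ⟨-, x, h1, h2, h3, h4, h5⟩ := hc
    obtain ⟨-, y, k1, k2, k3, k4, k5⟩ := hc'
    simp only [Prod.mk.injEq] at h he hf he' hf' hs h1 h2 h3 h4 h5 k1 k2 k3 k4 k5 ⊢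
    obtain ⟨⟨hs1, hi1⟩, hs2, hi2⟩ := h
    have hxy : x = y := by
      refine Seg.eq_of_height_eq hs h5 ?_
      simpa [Seg.height, hs1, hi1, hs2, hi2] using k5
    subst hxy
    exact ⟨eq_of_mem_consecutiveSegs_of_line_eq he he' hs1 hi1 h1 h2 k1 k2,
      eq_of_mem_consecutiveSegs_of_line_eq hf hf' hs2 hi2 h3 h4 k3 k4⟩

open scoped Classical in
/-- The endpoints of a segment. -/
noncomputable def Seg.ends (e : Seg) : Finset (ℝ × ℝ) := {e.leftPt, e.rightPt}

lemma card_ends {V L : Finset (ℝ × ℝ)} {e : Seg} (he : e ∈ consecutiveSegs V L) :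
    e.ends.card = 2 := by
  refine Finset.card_pair fun h => ?_
  have := congrArg Prod.fst h
  exact (mem_consecutiveSegs.1 he).2.2.2.1.ne this

lemma ends_subset {V L : Finset (ℝ × ℝ)} {e : Seg} (he : e ∈ consecutiveSegs V L) :
    e.ends ⊆ V := by
  obtain ⟨-, h1, h2, -⟩ := mem_consecutiveSegs.1 he
  simp [Seg.ends, Finset.insert_subset_iff, h1, h2]

lemma disjoint_ends {V L : Finset (ℝ × ℝ)} {e f : Seg} (he : e ∈ consecutiveSegs V L)
    (hf : f ∈ consecutiveSegs V L) (h : e.Crosses f) : Disjoint e.ends f.ends := by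
  have hs := line_ne_of_crosses he hf h
  obtain ⟨-, x, h1, h2, h3, h4, h5⟩ := h
  rw [Finset.disjoint_left]
  intro z hze hzf
  have h6 : z.2 = e.height z.1 ∧ z.1 ≠ x := by
    simp only [Seg.ends, Finset.mem_insert, Finset.mem_singleton] at hze
    rcases hze with rfl | rfl
    exacts [⟨rfl, h1.ne⟩, ⟨rfl, h2.ne'⟩]
  have h7 : z.2 = f.height z.1 := by
    simp only [Seg.ends, Finset.mem_insert, Finset.mem_singleton] at hzf
    rcases hzf with rfl | rfl <;> rfl
  exact h6.2 (Seg.eq_of_height_eq hs (h6.1.symm.trans h7) h5)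

open scoped Classical in
lemma card_segs_sub_card_crossingPairs_le {V L S : Finset (ℝ × ℝ)} (hS : S ⊆ V) :
    ((consecutiveSegs V L).filter fun e => e.ends ⊆ S).card ≤
      ((crossingPairs (consecutiveSegs V L)).filter fun t => t.1.ends ∪ t.2.ends ⊆ S).card +
        3 * S.card := by
  set E := (consecutiveSegs V L).filter fun e => e.ends ⊆ S with hE
  set X := (crossingPairs (consecutiveSegs V L)).filter fun t => t.1.ends ∪ t.2.ends ⊆ S with hX
  have hplane : IsPlaneGraph (S : Set (ℝ × ℝ)) ((E \ X.image Prod.fst : Finset Seg) : Set Seg) := by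
    have hmem : ∀ e ∈ ((E \ X.image Prod.fst : Finset Seg) : Set Seg), e ∈ consecutiveSegs V L ∧
        e.leftPt ∈ S ∧ e.rightPt ∈ S := by
      intro e he
      have he := Finset.mem_filter.1 (Finset.mem_sdiff.1 (Finset.mem_coe.1 he)).1
      refine ⟨he.1, he.2 ?_, he.2 ?_⟩ <;> simp [Seg.ends]
    refine ⟨fun e he => (mem_consecutiveSegs.1 (hmem e he).1).2.2.2.1, fun e he => (hmem e he).2.1,
      fun e he => (hmem e he).2.2, fun e he v hv =>
        (mem_consecutiveSegs.1 (hmem e he).1).2.2.2.2 v (hS hv), ?_⟩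
    intro e he f hf x h1 h2 h3 h4 h5
    by_contra hne
    have he' := Finset.mem_sdiff.1 (Finset.mem_coe.1 he)
    have hf' := Finset.mem_sdiff.1 (Finset.mem_coe.1 hf)
    refine he'.2 (Finset.mem_image.2 ⟨(e, f), Finset.mem_filter.2 ⟨mem_crossingPairs.2
      ⟨(hmem e he).1, (hmem f hf).1, hne, x, h1, h2, h3, h4, h5⟩, ?_⟩, rfl⟩)
    exact Finset.union_subset (Finset.mem_filter.1 he'.1).2 (Finset.mem_filter.1 hf'.1).2
  have h1 := hplane.card_le
  have h2 := Finset.le_card_sdiff (X.image Prod.fst) E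
  have h3 := Finset.card_image_le (s := X) (f := Prod.fst)
  omega

lemma sq_mul_card_consecutiveSegs_le (V L : Finset (ℝ × ℝ)) {p : ℝ} (hp : 0 ≤ p) (hp' : p ≤ 1) :
    p ^ 2 * (consecutiveSegs V L).card ≤ p ^ 4 * (L.card : ℝ) ^ 2 + 3 * (p * V.card) := by
  classical
  set E := consecutiveSegs V L with hE
  have h1 := sum_binomialWeight_mul_card p E Seg.ends 2 (fun e he => ends_subset he)
    (fun e he => card_ends he)
  have h2 := sum_binomialWeight_mul_card (V := V) p (crossingPairs E)
    (fun t => t.1.ends ∪ t.2.ends) 4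
    (fun t ht =>
      have ht := mem_crossingPairs.1 ht
      Finset.union_subset (ends_subset ht.1) (ends_subset ht.2.1))
    (fun t ht => by
      have ht := mem_crossingPairs.1 ht
      rw [Finset.card_union_of_disjoint (disjoint_ends ht.1 ht.2.1 ht.2.2), card_ends ht.1,
        card_ends ht.2.1])
  have h3 := sum_binomialWeight_mul_card_self V p
  have h4 : p ^ 4 * ((crossingPairs E).card : ℝ) ≤ p ^ 4 * (L.card : ℝ) ^ 2 :=
    mul_le_mul_of_nonneg_left (by exact_mod_cast card_crossingPairs_le V L) (by positivity)
  refine le_trans ?_ (add_le_add_left h4 _)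
  rw [← h1, ← h2, ← h3, Finset.mul_sum, ← Finset.sum_add_distrib]
  refine Finset.sum_le_sum fun S hS => ?_
  have h5 := card_segs_sub_card_crossingPairs_le (L := L) (Finset.mem_powerset.1 hS)
  have h6 : ((E.filter fun e => e.ends ⊆ S).card : ℝ) ≤
      ((crossingPairs E).filter fun t => t.1.ends ∪ t.2.ends ⊆ S).card + 3 * S.card := by
    exact_mod_cast h5
  have := mul_le_mul_of_nonneg_left h6 (binomialWeight_nonneg V hp hp' S)
  linarith

/-- A Szemerédi–Trotter bound for the number of lines containing at least `t` points. -/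
lemma card_richLines_mul_cube_le (V L : Finset (ℝ × ℝ)) {t : ℕ} (ht : 2 ≤ t)
    (htV : t ^ 2 ≤ V.card) (hL : ∀ ℓ ∈ L, t ≤ (linePts V ℓ).card) :
    L.card * t ^ 3 ≤ 576 * V.card ^ 2 := by
  have hE : L.card * (t - 1) ≤ (consecutiveSegs V L).card := by
    refine le_trans ?_ (sum_card_linePts_sub_one_le V L)
    rw [← smul_eq_mul]
    exact Finset.card_nsmul_le_sum _ _ _ fun ℓ hℓ => Nat.sub_le_sub_right (hL ℓ hℓ) 1
  have hE' : (L.card : ℝ) * t ≤ 2 * (consecutiveSegs V L).card := by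
    have : L.card * t ≤ 2 * (L.card * (t - 1)) := by
      obtain ⟨s, rfl⟩ := Nat.exists_eq_add_of_le ht
      have : 2 + s - 1 = s + 1 := by omega
      rw [this]
      nlinarith [Nat.zero_le (L.card * s)]
    exact_mod_cast this.trans (Nat.mul_le_mul_left 2 hE)
  have ht' : (2 : ℝ) ≤ t := by exact_mod_cast ht
  have htV' : (t : ℝ) ^ 2 ≤ V.card := by exact_mod_cast htV
  suffices (L.card : ℝ) * t ^ 3 ≤ 576 * V.card ^ 2 by exact_mod_cast this
  have key := fun p hp hp' => sq_mul_card_consecutiveSegs_le V L (p := p) hp hp'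
  set m := (L.card : ℝ)
  set n := (V.card : ℝ)
  set s := (t : ℝ)
  set E := ((consecutiveSegs V L).card : ℝ)
  have hm : 0 ≤ m := Nat.cast_nonneg _
  have hn : 0 ≤ n := Nat.cast_nonneg _
  rcases le_or_gt (4 * m) s with hms | hms
  · have h1 := key 1 zero_le_one le_rfl
    have h2 : m * s ≤ 12 * n := by nlinarith
    calc m * s ^ 3 = m * s * s ^ 2 := by ring
      _ ≤ 12 * n * n := by gcongr
      _ ≤ 576 * n ^ 2 := by nlinarith [sq_nonneg n]
  · have hm' : 0 < m := by linarith
    set p := √(s / (4 * m)) with hp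
    have hp0 : 0 < p := Real.sqrt_pos.2 (by positivity)
    have hp2 : p ^ 2 = s / (4 * m) := Real.sq_sqrt (by positivity)
    have hp1 : p ≤ 1 := by
      rw [hp, Real.sqrt_le_one, div_le_one (by positivity)]
      exact hms.le
    have h1 := key p hp0.le hp1
    have hpm : p ^ 2 * (4 * m) = s := by rw [hp2]; field_simp
    have h2 : p * (m * s) ≤ 12 * n := by
      have h3 : p * (p * (m * s)) ≤ p * (12 * n) := by
        have h4 : p ^ 2 * (m * s) ≤ p ^ 2 * (2 * E) :=
          mul_le_mul_of_nonneg_left hE' (by positivity)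
        have h5 : p ^ 4 * m ^ 2 = p ^ 2 * (m * s) / 4 := by rw [← hpm]; ring
        nlinarith
      exact le_of_mul_le_mul_left h3 hp0
    have h3 : (p * (m * s)) ^ 2 ≤ (12 * n) ^ 2 := by gcongr
    have h4 : (p * (m * s)) ^ 2 = m * s ^ 3 / 4 := by
      rw [mul_pow, hp2]; field_simp
    nlinarith

end RichLines

section CollinearQuadruples

lemma collinear_linePts (V : Finset (ℝ × ℝ)) (ℓ : ℝ × ℝ) :
    Collinear ℝ (linePts V ℓ : Set (ℝ × ℝ)) := by
  rw [collinear_iff_exists_forall_eq_smul_vadd]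
  refine ⟨(0, ℓ.2), (1, ℓ.1), fun v hv => ⟨v.1, Prod.ext ?_ ?_⟩⟩
  · simp
  · simpa [mul_comm] using (mem_linePts.1 hv).2

lemma collinear_of_fst_eq {s : Set (ℝ × ℝ)} {x : ℝ} (h : ∀ v ∈ s, v.1 = x) :
    Collinear ℝ s := by
  rw [collinear_iff_exists_forall_eq_smul_vadd]
  exact ⟨(x, 0), (0, 1), fun v hv => ⟨v.2, Prod.ext (by simpa using h v hv) (by simp)⟩⟩

lemma Collinear.fst_eq_or_exists_line {s : Set (ℝ × ℝ)} (h : Collinear ℝ s) :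
    (∃ x, ∀ v ∈ s, v.1 = x) ∨ ∃ ℓ : ℝ × ℝ, ∀ v ∈ s, v.2 = ℓ.1 * v.1 + ℓ.2 := by
  obtain ⟨u, d, h⟩ := (collinear_iff_exists_forall_eq_smul_vadd s).1 h
  by_cases hd : d.1 = 0
  · refine .inl ⟨u.1, fun v hv => ?_⟩
    obtain ⟨r, rfl⟩ := h v hv
    simp [hd]
  · refine .inr ⟨(d.2 / d.1, u.2 - d.2 / d.1 * u.1), fun v hv => ?_⟩
    obtain ⟨r, rfl⟩ := h v hv
    simp only [vadd_eq_add, Prod.fst_add, Prod.snd_add, Prod.smul_fst, Prod.smul_snd, smul_eq_mul]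
    field_simp
    ring

lemma choose_four_le_sum_cube (l : ℕ) : l.choose 4 ≤ ∑ s ∈ Finset.range l, s ^ 3 := by
  induction l with
  | zero => simp
  | succ l ih =>
    rw [Finset.sum_range_succ, Nat.choose_succ_succ' l 3, add_comm]
    exact Nat.add_le_add ih (Nat.choose_le_pow l 3)

lemma sum_choose_four_linePts_le (V L : Finset (ℝ × ℝ)) {q : ℕ} (hq : q ^ 2 ≤ V.card)
    (hL : ∀ ℓ ∈ L, (linePts V ℓ).card < q) :
    ∑ ℓ ∈ L, (linePts V ℓ).card.choose 4 ≤ q * (576 * V.card ^ 2) := by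
  classical
  calc ∑ ℓ ∈ L, (linePts V ℓ).card.choose 4
      ≤ ∑ ℓ ∈ L, ∑ s ∈ Finset.range q, if s < (linePts V ℓ).card then s ^ 3 else 0 := by
        refine Finset.sum_le_sum fun ℓ hℓ => (choose_four_le_sum_cube _).trans ?_
        rw [← Finset.sum_filter]
        refine Finset.sum_le_sum_of_subset fun s hs => ?_
        have := Finset.mem_range.1 hs
        exact Finset.mem_filter.2 ⟨Finset.mem_range.2 (this.trans (hL ℓ hℓ)), this⟩
    _ = ∑ s ∈ Finset.range q, (L.filter fun ℓ => s < (linePts V ℓ).card).card * s ^ 3 := by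
        rw [Finset.sum_comm]
        refine Finset.sum_congr rfl fun s _ => ?_
        rw [← Finset.sum_filter, Finset.sum_const, smul_eq_mul]
    _ ≤ ∑ s ∈ Finset.range q, 576 * V.card ^ 2 := by
        refine Finset.sum_le_sum fun s hs => ?_
        rcases Nat.eq_zero_or_pos s with rfl | hs0
        · simp
        have hsq : s + 1 ≤ q := Finset.mem_range.1 hs
        refine le_trans (Nat.mul_le_mul_left _ (Nat.pow_le_pow_left s.le_succ 3)) ?_
        exact card_richLines_mul_cube_le V _ (by omega) ((Nat.pow_le_pow_left hsq 2).trans hq)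
          fun ℓ hℓ => (Finset.mem_filter.1 hℓ).2
    _ = q * (576 * V.card ^ 2) := by rw [Finset.sum_const, Finset.card_range, smul_eq_mul]

open scoped Classical in
lemma sum_choose_four_vertical_le (V : Finset (ℝ × ℝ)) {q : ℕ} (hq : q ^ 2 ≤ V.card)
    (hV : ∀ x, (V.filter fun v => v.1 = x).card < q) :
    ∑ x ∈ V.image Prod.fst, (V.filter fun v => v.1 = x).card.choose 4 ≤ q * V.card ^ 2 := by
  calc ∑ x ∈ V.image Prod.fst, (V.filter fun v => v.1 = x).card.choose 4
      ≤ ∑ x ∈ V.image Prod.fst, q ^ 3 * (V.filter fun v => v.1 = x).card := by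
        refine Finset.sum_le_sum fun x _ => (Nat.choose_le_pow _ 4).trans ?_
        rw [pow_succ]
        exact Nat.mul_le_mul_right _ (Nat.pow_le_pow_left (hV x).le 3)
    _ = q * (q ^ 2 * V.card) := by
        rw [← Finset.mul_sum, ← Finset.card_eq_sum_card_image]
        ring
    _ ≤ q * V.card ^ 2 := by
        rw [sq V.card]
        exact Nat.mul_le_mul_left _ (Nat.mul_le_mul_right _ hq)

open scoped Classical in
/-- The collinear four-point subsets of `V`. -/
noncomputable def collinearQuads (V : Finset (ℝ × ℝ)) : Finset (Finset (ℝ × ℝ)) :=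
  (V.powersetCard 4).filter fun T => Collinear ℝ (T : Set (ℝ × ℝ))

lemma mem_collinearQuads {V T : Finset (ℝ × ℝ)} :
    T ∈ collinearQuads V ↔ T ⊆ V ∧ T.card = 4 ∧ Collinear ℝ (T : Set (ℝ × ℝ)) := by
  simp [collinearQuads, Finset.mem_powersetCard, and_assoc]

lemma card_collinearQuads_le (V : Finset (ℝ × ℝ)) {q : ℕ} (hq : q ^ 2 ≤ V.card)
    (hV : ∀ T ⊆ V, Collinear ℝ (T : Set (ℝ × ℝ)) → T.card < q) :
    (collinearQuads V).card ≤ q * (577 * V.card ^ 2) := by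
  classical
  set line : (ℝ × ℝ) × (ℝ × ℝ) → ℝ × ℝ := fun t =>
    ((t.2.2 - t.1.2) / (t.2.1 - t.1.1),
      t.1.2 - (t.2.2 - t.1.2) / (t.2.1 - t.1.1) * t.1.1) with hline
  set L := (V ×ˢ V).image line with hL
  have hcover : collinearQuads V ⊆
      (L.biUnion fun ℓ => (linePts V ℓ).powersetCard 4) ∪
      ((V.image Prod.fst).biUnion fun x => (V.filter fun v => v.1 = x).powersetCard 4) := by
    intro T hT
    obtain ⟨hTV, hT4, hT⟩ := mem_collinearQuads.1 hT
    obtain ⟨u, hu, v, hv, huv⟩ := Finset.one_lt_card.1 (by omega : 1 < T.card)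
    rw [Finset.mem_union, Finset.mem_biUnion, Finset.mem_biUnion]
    rcases hT.fst_eq_or_exists_line with ⟨x, hx⟩ | ⟨ℓ, hℓ⟩
    · refine .inr ⟨x, Finset.mem_image.2 ⟨u, hTV hu, hx u hu⟩,
        Finset.mem_powersetCard.2 ⟨fun z hz => Finset.mem_filter.2 ⟨hTV hz, hx z hz⟩, hT4⟩⟩
    · refine .inl ⟨ℓ, Finset.mem_image.2 ⟨(u, v), Finset.mk_mem_product (hTV hu) (hTV hv), ?_⟩,
        Finset.mem_powersetCard.2 ⟨fun z hz => mem_linePts.2 ⟨hTV hz, hℓ z hz⟩, hT4⟩⟩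
      have h1 := hℓ u hu
      have h2 := hℓ v hv
      have h3 : v.1 - u.1 ≠ 0 := fun h => huv (Prod.ext (by linarith)
        (by rw [h1, h2, sub_eq_zero.1 h]))
      have h4 : (v.2 - u.2) / (v.1 - u.1) = ℓ.1 := by
        rw [div_eq_iff h3, h1, h2]; ring
      simp only [hline, h4]
      exact Prod.ext rfl (by simp only; linarith)
  have h1 := sum_choose_four_linePts_le V L hq fun ℓ _ =>
    hV _ (fun z hz => (mem_linePts.1 hz).1) (collinear_linePts V ℓ)
  have h2 := sum_choose_four_vertical_le V hq fun x =>
    hV _ (Finset.filter_subset _ _) (collinear_of_fst_eq (x := x) fun v hv =>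
      (Finset.mem_filter.1 (Finset.mem_coe.1 hv)).2)
  calc (collinearQuads V).card ≤ _ := Finset.card_le_card hcover
    _ ≤ _ := Finset.card_union_le _ _
    _ ≤ _ := Nat.add_le_add Finset.card_biUnion_le Finset.card_biUnion_le
    _ ≤ q * (576 * V.card ^ 2) + q * V.card ^ 2 := by
      simp only [Finset.card_powersetCard]
      exact Nat.add_le_add h1 h2
    _ = q * (577 * V.card ^ 2) := by ring

lemma exists_atMostCollinear_three_of_card_collinearQuads (V S : Finset (ℝ × ℝ)) {q : ℕ}
    (hSV : S ⊆ V) (hS : q + (collinearQuads S).card ≤ S.card) :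
    ∃ S' ⊆ V, S'.card = q ∧ AtMostCollinear S' 3 := by
  classical
  have hne : ∀ T ∈ collinearQuads S, ∃ v, v ∈ T := fun T hT =>
    Finset.card_pos.1 (by rw [(mem_collinearQuads.1 hT).2.1]; norm_num)
  choose! φ hφ using hne
  have h1 := Finset.le_card_sdiff ((collinearQuads S).image φ) S
  have h2 := Finset.card_image_le (s := collinearQuads S) (f := φ)
  obtain ⟨S', hS', hcard⟩ := Finset.exists_subset_card_eq
    (show q ≤ (S \ (collinearQuads S).image φ).card by omega)
  refine ⟨S', fun z hz => hSV (Finset.mem_sdiff.1 (hS' hz)).1, hcard, fun T hT hcol => ?_⟩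
  by_contra! h4
  obtain ⟨Q, hQT, hQ⟩ := Finset.exists_subset_card_eq (show 4 ≤ T.card from h4)
  have hQS' := (hQT.trans hT).trans hS'
  have hQm : Q ∈ collinearQuads S := mem_collinearQuads.2
    ⟨fun z hz => (Finset.mem_sdiff.1 (hQS' hz)).1, hQ, hcol.subset (by exact_mod_cast hQT)⟩
  exact (Finset.mem_sdiff.1 (hQS' (hφ Q hQm))).2 (Finset.mem_image_of_mem φ hQm)

lemma exists_le_card_sub_card_collinearQuads (V : Finset (ℝ × ℝ)) {p : ℝ} (hp : 0 ≤ p)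
    (hp' : p ≤ 1) : ∃ S ⊆ V,
      p * V.card - p ^ 4 * (collinearQuads V).card ≤ (S.card : ℝ) - (collinearQuads S).card := by
  classical
  by_contra! hcon
  set a := p * (V.card : ℝ) - p ^ 4 * (collinearQuads V).card with ha
  have h1 := sum_binomialWeight_mul_card_self V p
  have h2 := sum_binomialWeight_mul_card (V := V) p (collinearQuads V) id 4
    (fun T hT => (mem_collinearQuads.1 hT).1) (fun T hT => (mem_collinearQuads.1 hT).2.1)
  have h3 := sum_binomialWeight V p
  have hquads : ∀ S ⊆ V, (collinearQuads V).filter (fun T => id T ⊆ S) = collinearQuads S := by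
    intro S hS
    ext T
    simp only [Finset.mem_filter, mem_collinearQuads, id]
    exact ⟨fun h => ⟨h.2, h.1.2⟩, fun h => ⟨⟨h.1.trans hS, h.2⟩, h.1⟩⟩
  have h4 : ∑ S ∈ V.powerset, binomialWeight V p S *
      ((S.card : ℝ) - (collinearQuads S).card - a) = 0 := by
    have : ∀ S ∈ V.powerset, binomialWeight V p S *
        ((S.card : ℝ) - (collinearQuads S).card - a) = binomialWeight V p S * S.card -
        binomialWeight V p S * ((collinearQuads V).filter fun T => id T ⊆ S).card -
        binomialWeight V p S * a := fun S hS => by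
      rw [hquads S (Finset.mem_powerset.1 hS)]; ring
    rw [Finset.sum_congr rfl this, Finset.sum_sub_distrib, Finset.sum_sub_distrib, h1, h2,
      ← Finset.sum_mul, h3, ha]
    ring
  have h5 : ∀ S ∈ V.powerset, binomialWeight V p S *
      ((S.card : ℝ) - (collinearQuads S).card - a) ≤ 0 := fun S hS =>
    mul_nonpos_of_nonneg_of_nonpos (binomialWeight_nonneg V hp hp' S)
      (by linarith [hcon S (Finset.mem_powerset.1 hS)])
  have h6 := (Finset.sum_eq_zero_iff_of_nonpos h5).1 h4
  have h7 : ∀ S ∈ V.powerset, binomialWeight V p S = 0 := fun S hS =>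
    (mul_eq_zero.1 (h6 S hS)).resolve_right
      (by linarith [hcon S (Finset.mem_powerset.1 hS)] : _ < (0 : ℝ)).ne
  rw [Finset.sum_eq_zero h7] at h3
  exact zero_ne_one h3

end CollinearQuadruples

/-- For every `k ≥ 3` there is `c > 0` such that for every `q > k`, every finite set of
at least `c·q²` points in the plane contains `q` collinear points or `q` points with at
most `k` collinear (i.e. `GP_k(q) ≤ O(q²)`). -/
theorem GPk_upper_bound :
    ∀ k : ℕ, 3 ≤ k →
    ∃ c : ℝ, 0 < c ∧
      ∀ q : ℕ, k < q →
        ∀ P : Finset (ℝ × ℝ),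
          c * (q : ℝ) ^ 2 ≤ P.card →
          (∃ S ⊆ P, S.card = q ∧ Collinear ℝ (S : Set (ℝ × ℝ))) ∨
          (∃ S ⊆ P, S.card = q ∧ AtMostCollinear S k) := by
  intro k hk
  refine ⟨98, by norm_num, fun q hq P hP => or_iff_not_imp_left.2 fun hcol => ?_⟩
  have hP' : 98 * q ^ 2 ≤ P.card := by exact_mod_cast hP
  obtain ⟨V, hVP, hV⟩ := Finset.exists_subset_card_eq hP'
  have hVcol : ∀ T ⊆ V, Collinear ℝ (T : Set (ℝ × ℝ)) → T.card < q := by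
    intro T hT hTcol
    by_contra! hlt
    obtain ⟨S, hST, hS⟩ := Finset.exists_subset_card_eq hlt
    exact hcol ⟨S, (hST.trans hT).trans hVP, hS, hTcol.subset (by exact_mod_cast hST)⟩
  have hquads := card_collinearQuads_le V (by omega) hVcol
  rw [hV] at hquads
  have hquads' : ((collinearQuads V).card : ℝ) ≤ q * (577 * (98 * q ^ 2) ^ 2) := by
    exact_mod_cast hquads
  have hq1 : (1 : ℝ) ≤ q := by exact_mod_cast (by omega : 1 ≤ q)
  obtain ⟨S, hSV, hS⟩ := exists_le_card_sub_card_collinearQuads V (p := 1 / (49 * q))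
    (by positivity) (by rw [div_le_one (by positivity)]; linarith)
  have hS' : (q : ℝ) + (collinearQuads S).card ≤ S.card := by
    have h1 : 1 / (49 * (q : ℝ)) * V.card = 2 * q := by
      rw [hV]; push_cast; field_simp; norm_num
    have h2 : (1 / (49 * (q : ℝ))) ^ 4 * (collinearQuads V).card ≤ q := by
      calc _ ≤ (1 / (49 * (q : ℝ))) ^ 4 * (q * (577 * (98 * q ^ 2) ^ 2)) := by gcongr
        _ = 2308 / 2401 * q := by field_simp; norm_num
        _ ≤ q := by linarith
    linarith
  obtain ⟨S', hS'V, hcard, hthree⟩ :=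
    exists_atMostCollinear_three_of_card_collinearQuads V S (q := q) hSV (by exact_mod_cast hS')
  exact ⟨S', hS'V.trans hVP, hcard, fun T hT hTcol => (hthree T hT hTcol).trans hk⟩
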